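/- arXiv:2008.08110 — 3 statements merged into one kernel-verified Lean document; each statement's English description precedes it below -/
import Mathlib

section
/- A numerical semigroup S ≠ ℕ is almost symmetric if and only if its T-set T(S) is itself a numerical semigroup (i.e. T(S) is closed under addition). -/
open scoped Classical

/-- A numerical set: a subset of ℕ containing 0 with finite complement. -/
def NumericalSet (H : Set ℕ) : Prop := 0 ∈ H ∧ Hᶜ.Finite

/-- A numerical semigroup: a numerical set closed under addition. -/
def NumericalSemigroup (S : Set ℕ) : Prop :=
  NumericalSet S ∧ ∀ a ∈ S, ∀ b ∈ S, a + b ∈ S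

/-- Frobenius number: the largest gap. -/
noncomputable def frob (H : Set ℕ) : ℕ := sSup Hᶜ

/-- Genus: the number of gaps. -/
noncomputable def genus (H : Set ℕ) : ℕ := Hᶜ.ncard

/-- Multiplicity: the smallest nonzero element. -/
noncomputable def mult (H : Set ℕ) : ℕ := sInf {x | x ∈ H ∧ x ≠ 0}

/-- The T-set of a numerical set.  (With truncated subtraction, every `x ≥ frob H`
satisfies `frob H - x = 0`, matching the convention that `F(H) - x` computed in ℤ
is nonpositive, hence not a nonzero element of `H`.) -/
def Tset (H : Set ℕ) : Set ℕ := {x | frob H - x ∉ H ∨ frob H - x = 0}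

/-- The associated numerical semigroup of a numerical set. -/
def A (H : Set ℕ) : Set ℕ := {x | ∀ h ∈ H, x + h ∈ H}

/-- `A*`-operation on numerical sets. -/
def Astar (H : Set ℕ) : Set ℕ := {a | ∀ h ∈ H, h ≠ 0 → a + h ∈ H}

/-- Pseudo-Frobenius numbers of a numerical set. -/
def PF (H : Set ℕ) : Set ℕ := {a | a ∉ H ∧ ∀ h ∈ H, h ≠ 0 → a + h ∈ H}

/-- Type of a numerical set. -/
noncomputable def typ (H : Set ℕ) : ℕ := (PF H).ncard

/-- Almost symmetric: `t(S) = 2 g(S) - F(S)`. -/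
def AlmostSymmetric (S : Set ℕ) : Prop :=
  (typ S : ℤ) = 2 * (genus S : ℤ) - (frob S : ℤ)

/-- An ordinary numerical set: `{0} ∪ {x : x > F(H)}`. -/
def Ordinary (H : Set ℕ) : Prop := H = insert 0 {x : ℕ | frob H < x}

theorem frob_notMem {H : Set ℕ} (hfin : Hᶜ.Finite) (hne : H ≠ Set.univ) : frob H ∉ H :=
  Nat.sSup_mem (Set.nonempty_compl.mpr hne) hfin.bddAbove

theorem le_frob {H : Set ℕ} (hfin : Hᶜ.Finite) {x : ℕ} (hx : x ∉ H) : x ≤ frob H :=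
  le_csSup hfin.bddAbove hx

/-- The gaps `x` of `H` such that `frob H - x` is also a gap. -/
noncomputable def secondKindGaps (H : Set ℕ) : Finset ℕ :=
  (Finset.range (frob H + 1)).filter fun x => x ∉ H ∧ frob H - x ∉ H

theorem mem_secondKindGaps {H : Set ℕ} (hfin : Hᶜ.Finite) {x : ℕ} :
    x ∈ secondKindGaps H ↔ x ∉ H ∧ frob H - x ∉ H := by
  simp only [secondKindGaps, Finset.mem_filter, Finset.mem_range, and_iff_right_iff_imp]
  exact fun h => Nat.lt_succ_of_le (le_frob hfin h.1)

theorem frob_notMem_secondKindGaps {H : Set ℕ} (hH : NumericalSet H) :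
    frob H ∉ secondKindGaps H := by
  simp [mem_secondKindGaps hH.2, hH.1]

/-- For a numerical semigroup, reflection in `frob S` pairs the elements below `frob S` with the
gaps that are not of the second kind. -/
theorem two_mul_genus {S : Set ℕ} (hS : NumericalSemigroup S) (hne : S ≠ Set.univ) :
    2 * genus S = frob S + 1 + (secondKindGaps S).card := by
  have hF := frob_notMem hS.1.2 hne
  set R := Finset.range (frob S + 1) with hR
  have hgenus : genus S = (R.filter (· ∉ S)).card := by
    rw [genus, ← Set.ncard_coe_finset]
    congr 1
    ext x
    simpa [hR] using fun h => le_frob hS.1.2 h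
  have hcompl : (R.filter (· ∈ S)).card + (R.filter (· ∉ S)).card = frob S + 1 := by
    rw [Finset.card_filter_add_card_filter_not, hR, Finset.card_range]
  have hsplit := Finset.card_filter_add_card_filter_not (s := R.filter (· ∉ S))
    (fun x => frob S - x ∈ S)
  have hreflect : ((R.filter (· ∉ S)).filter fun x => frob S - x ∈ S).card =
      (R.filter (· ∈ S)).card := by
    refine Finset.card_nbij' (frob S - ·) (frob S - ·) ?_ ?_ ?_ ?_
    · intro x hx
      simp only [hR, Finset.coe_filter, Finset.mem_filter, Finset.mem_range,
        Set.mem_ofPred_eq] at hx ⊢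
      exact ⟨by omega, hx.2⟩
    · intro x hx
      simp only [hR, Finset.coe_filter, Finset.mem_filter, Finset.mem_range,
        Set.mem_ofPred_eq] at hx ⊢
      have hsub : frob S - (frob S - x) = x := by omega
      refine ⟨⟨by omega, fun h => hF ?_⟩, by rw [hsub]; exact hx.2⟩
      simpa [Nat.sub_add_cancel (Nat.lt_succ_iff.mp hx.1)] using hS.2 _ h _ hx.2
    · intro x hx
      simp only [hR, Finset.coe_filter, Finset.mem_filter, Finset.mem_range,
        Set.mem_ofPred_eq] at hx
      dsimp only
      omega
    · intro x hx
      simp only [hR, Finset.coe_filter, Finset.mem_range, Set.mem_ofPred_eq] at hx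
      dsimp only
      omega
  rw [hreflect, Finset.filter_filter] at hsplit
  rw [secondKindGaps, ← hR]
  omega

theorem PF_subset {H : Set ℕ} (hfin : Hᶜ.Finite) (hne : H ≠ Set.univ) :
    PF H ⊆ ↑(insert (frob H) (secondKindGaps H)) := by
  rintro x ⟨hx, hadd⟩
  rw [Finset.mem_coe, Finset.mem_insert, mem_secondKindGaps hfin]
  by_contra! h
  have hle := le_frob hfin hx
  have := hadd _ (h.2 hx) (by omega)
  rw [Nat.add_sub_cancel' hle] at this
  exact frob_notMem hfin hne this

theorem frob_mem_PF {H : Set ℕ} (hfin : Hᶜ.Finite) (hne : H ≠ Set.univ) : frob H ∈ PF H := by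
  refine ⟨frob_notMem hfin hne, fun h _ h0 => ?_⟩
  by_contra hn
  have := le_frob hfin hn
  omega

theorem almostSymmetric_iff {S : Set ℕ} (hS : NumericalSemigroup S) (hne : S ≠ Set.univ) :
    AlmostSymmetric S ↔ ∀ x ∉ S, frob S - x ∉ S → x ∈ PF S := by
  have hg := two_mul_genus hS hne
  have hcard := Finset.card_insert_of_notMem (frob_notMem_secondKindGaps hS.1)
  have hsub := PF_subset hS.1.2 hne
  have hiff : AlmostSymmetric S ↔ typ S = (insert (frob S) (secondKindGaps S)).card := by
    rw [AlmostSymmetric]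
    omega
  rw [hiff, typ, ← Set.ncard_coe_finset]
  constructor
  · intro h x hx hx'
    rw [Set.eq_of_subset_of_ncard_le hsub h.ge, Finset.mem_coe]
    exact Finset.mem_insert_of_mem ((mem_secondKindGaps hS.1.2).2 ⟨hx, hx'⟩)
  · intro h
    congr 1
    refine hsub.antisymm fun x hx => ?_
    rw [Finset.mem_coe, Finset.mem_insert, mem_secondKindGaps hS.1.2] at hx
    rcases hx with rfl | hx
    · exact frob_mem_PF hS.1.2 hne
    · exact h x hx.1 hx.2

theorem numericalSet_Tset {H : Set ℕ} (hfin : Hᶜ.Finite) (hne : H ≠ Set.univ) :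
    NumericalSet (Tset H) := by
  refine ⟨Or.inl (by simpa using frob_notMem hfin hne), ?_⟩
  refine (Set.finite_Iio (frob H)).subset fun x hx => ?_
  by_contra h
  exact hx (Or.inr (Nat.sub_eq_zero_of_le (not_lt.mp h)))

theorem stmt_2 (S : Set ℕ) (hS : NumericalSemigroup S) (hne : S ≠ Set.univ) :
    AlmostSymmetric S ↔ NumericalSemigroup (Tset S) := by
  rw [almostSymmetric_iff hS hne]
  constructor
  · intro h
    refine ⟨numericalSet_Tset hS.1.2 hne, fun a ha b hb => ?_⟩
    by_contra hab
    simp only [Tset, Set.mem_ofPred_eq, not_or, not_not] at ha hb hab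
    obtain ⟨hs, hs0⟩ := hab
    have ha' : frob S - a ∉ S := ha.resolve_right (by omega)
    have hb' : frob S - b ∉ S := hb.resolve_right (by omega)
    have hsum : a + (frob S - (a + b)) = frob S - b := by omega
    by_cases haS : a ∈ S
    · exact hb' (hsum ▸ hS.2 a haS _ hs)
    · exact hb' (hsum ▸ (h a haS ha').2 _ hs hs0)
  · intro hT x hx hx'
    refine ⟨hx, fun s hs hs0 => ?_⟩
    by_contra hxs
    have hle := le_frob hS.1.2 hxs
    have hxT : x ∈ Tset S := Or.inl hx'
    have hyT : frob S - (x + s) ∈ Tset S := by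
      left
      rwa [Nat.sub_sub_self hle]
    have hsum := hT.2 _ hxT _ hyT
    have heq : frob S - (x + (frob S - (x + s))) = s := by omega
    simp only [Tset, Set.mem_ofPred_eq, heq] at hsum
    exact hsum.elim (fun h => h hs) hs0
end

section
/- Let α and F be positive integers with F > 4α − 6. Then the map S ↦ T(S) is a bijection from the set of numerical semigroups with Frobenius number F and type F − α onto the set of numerical sets T satisfying g(T) + g(A(T)) = α. -/
open scoped Classical

theorem NumericalSet.mem_of_frob_lt {H : Set ℕ} (hH : NumericalSet H) {x : ℕ}
    (hx : frob H < x) : x ∈ H := by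
  by_contra hxH
  exact absurd (le_csSup hH.2.bddAbove hxH) (not_le.mpr hx)

theorem NumericalSet.frob_notMem {H : Set ℕ} (hH : NumericalSet H) (hne : Hᶜ.Nonempty) :
    frob H ∉ H :=
  Nat.sSup_mem hne hH.2.bddAbove

theorem NumericalSet.frob_notMem_of_pos {H : Set ℕ} (hH : NumericalSet H) (hpos : 0 < frob H) :
    frob H ∉ H := by
  refine hH.frob_notMem (Set.nonempty_iff_ne_empty.mpr fun he => ?_)
  simp [frob, he] at hpos

theorem frob_eq_of_isGreatest {H : Set ℕ} {F : ℕ} (h : IsGreatest Hᶜ F) : frob H = F :=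
  h.csSup_eq

theorem NumericalSet.compl_Tset {H : Set ℕ} (hH : NumericalSet H) (hpos : 0 < frob H) :
    (Tset H)ᶜ = (fun s => frob H - s) '' (H ∩ Set.Ioo 0 (frob H)) := by
  ext x
  simp only [Tset, Set.mem_compl_iff, Set.mem_ofPred_eq, not_or, not_not,
    Set.mem_image, Set.mem_inter_iff, Set.mem_Ioo]
  constructor
  · rintro ⟨h1, h2⟩
    have hx : x ≠ 0 := by
      rintro rfl
      exact hH.frob_notMem_of_pos hpos h1
    exact ⟨frob H - x, ⟨h1, by omega, by omega⟩, by omega⟩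
  · rintro ⟨s, ⟨hs, h0, hF⟩, rfl⟩
    rw [Nat.sub_sub_self hF.le]
    exact ⟨hs, h0.ne'⟩

theorem NumericalSet.tset {H : Set ℕ} (hH : NumericalSet H) (hpos : 0 < frob H) :
    NumericalSet (Tset H) := by
  refine ⟨Or.inl (by simpa using hH.frob_notMem_of_pos hpos), ?_⟩
  rw [hH.compl_Tset hpos]
  exact ((Set.finite_Ioo _ _).inter_of_right _).image _

theorem NumericalSet.genus_Tset_add_genus {H : Set ℕ} (hH : NumericalSet H)
    (hpos : 0 < frob H) : genus (Tset H) + genus H = frob H := by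
  have hinj : Set.InjOn (fun s => frob H - s) (H ∩ Set.Ioo 0 (frob H)) := by
    rintro a ⟨-, -, ha⟩ b ⟨-, -, hb⟩ hab
    simp only at hab
    omega
  have hunion : (H ∩ Set.Ioo 0 (frob H)) ∪ Hᶜ = Set.Icc 1 (frob H) := by
    ext x
    simp only [Set.mem_union, Set.mem_inter_iff, Set.mem_Ioo, Set.mem_compl_iff, Set.mem_Icc]
    constructor
    · rintro (⟨-, h0, hF⟩ | hx)
      · exact ⟨h0, hF.le⟩
      · exact ⟨Nat.pos_of_ne_zero fun h0 => hx (h0 ▸ hH.1),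
          not_lt.mp fun hlt => hx (hH.mem_of_frob_lt hlt)⟩
    · rintro ⟨h1, h2⟩
      by_cases hx : x ∈ H
      · refine Or.inl ⟨hx, h1, lt_of_le_of_ne h2 fun he => ?_⟩
        exact hH.frob_notMem_of_pos hpos (he ▸ hx)
      · exact Or.inr hx
  have hdisj : Disjoint (H ∩ Set.Ioo 0 (frob H)) Hᶜ :=
    disjoint_compl_right.mono_left Set.inter_subset_left
  rw [genus, genus, hH.compl_Tset hpos, hinj.ncard_image,
    ← Set.ncard_union_eq hdisj ((Set.finite_Ioo _ _).inter_of_right _) hH.2, hunion,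
    ← Finset.coe_Icc, Set.ncard_coe_finset, Nat.card_Icc]
  omega

theorem NumericalSemigroup.A_Tset {S : Set ℕ} (hS : NumericalSemigroup S) (hpos : 0 < frob S) :
    A (Tset S) = S ∪ PF S := by
  have hF := hS.1.frob_notMem_of_pos hpos
  have key : ∀ x, x ∈ A (Tset S) ↔ ∀ s ∈ S, s ≠ 0 → x + s ∈ S := by
    intro x
    constructor
    · intro hx s hs hs0
      by_contra hxs
      have hle : x + s ≤ frob S := not_lt.mp fun hlt => hxs (hS.1.mem_of_frob_lt hlt)
      have ht : frob S - (x + s) ∈ Tset S := by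
        refine Or.inl ?_
        rwa [Nat.sub_sub_self hle]
      have hmem := hx _ ht
      have heq : frob S - (x + (frob S - (x + s))) = s := by omega
      rw [Tset, Set.mem_ofPred_eq, heq] at hmem
      exact hmem.elim (fun h => h hs) hs0
    · intro hx t ht
      by_contra hxt
      simp only [Tset, Set.mem_ofPred_eq, not_or, not_not] at hxt
      obtain ⟨hmem, hne⟩ := hxt
      have hsum := hx _ hmem hne
      have heq : x + (frob S - (x + t)) = frob S - t := by omega
      rw [heq] at hsum
      rcases ht with ht | ht
      · exact ht hsum
      · omega
  ext x
  rw [key]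
  simp only [PF, Set.mem_union, Set.mem_ofPred_eq]
  constructor
  · intro hx
    by_cases hxS : x ∈ S
    · exact Or.inl hxS
    · exact Or.inr ⟨hxS, hx⟩
  · rintro (hx | ⟨-, hx⟩)
    · exact fun s hs _ => hS.2 x hx s hs
    · exact hx

theorem NumericalSemigroup.genus_A_Tset_add_typ {S : Set ℕ} (hS : NumericalSemigroup S)
    (hpos : 0 < frob S) : genus (A (Tset S)) + typ S = genus S := by
  have hsub : PF S ⊆ Sᶜ := fun x hx => hx.1
  rw [genus, typ, genus, hS.A_Tset hpos, Set.compl_union, ← Set.sdiff_eq]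
  exact Set.ncard_sdiff_add_ncard_of_subset hsub hS.1.2

theorem NumericalSemigroup.genus_Tset_add_genus_A_Tset_add_typ {S : Set ℕ}
    (hS : NumericalSemigroup S) (hpos : 0 < frob S) :
    genus (Tset S) + genus (A (Tset S)) + typ S = frob S := by
  rw [add_assoc, hS.genus_A_Tset_add_typ hpos, hS.1.genus_Tset_add_genus hpos]

theorem mem_iff_frob_sub_notMem_Tset {H : Set ℕ} {x : ℕ} (h0 : 0 < x) (hx : x ≤ frob H) :
    x ∈ H ↔ frob H - x ∉ Tset H := by
  simp only [Tset, Set.mem_ofPred_eq, Nat.sub_sub_self hx, not_or, not_not]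
  exact ⟨fun h => ⟨h, h0.ne'⟩, And.left⟩

theorem NumericalSet.eq_of_Tset_eq {H K : Set ℕ} (hH : NumericalSet H) (hK : NumericalSet K)
    (hF : frob H = frob K) (hT : Tset H = Tset K) : H = K := by
  ext x
  rcases Nat.eq_zero_or_pos x with rfl | h0
  · exact iff_of_true hH.1 hK.1
  rcases lt_or_ge (frob H) x with hx | hx
  · exact iff_of_true (hH.mem_of_frob_lt hx) (hK.mem_of_frob_lt (hF ▸ hx))
  · rw [mem_iff_frob_sub_notMem_Tset h0 hx, mem_iff_frob_sub_notMem_Tset h0 (hF ▸ hx), hT, hF]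

theorem NumericalSet.compl_A_finite {T : Set ℕ} (hT : NumericalSet T) : (A T)ᶜ.Finite := by
  refine (Set.finite_Iic (frob T)).subset fun x hx =>
    Set.mem_Iic.mpr <| not_lt.mp fun hlt => hx fun t _ => ?_
  exact hT.mem_of_frob_lt (by omega)

theorem NumericalSet.frob_lt_two_mul_genus_A {T : Set ℕ} (hT : NumericalSet T)
    (hne : Tᶜ.Nonempty) : frob T < 2 * genus (A T) := by
  have hfin := hT.compl_A_finite
  have hsub : Set.Iic (frob T) ⊆ (A T)ᶜ ∪ (fun x => frob T - x) '' (A T)ᶜ := by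
    intro x hx
    have hxF : x ≤ frob T := hx
    by_cases hxA : x ∈ A T
    · refine Or.inr ⟨frob T - x, fun hA => hT.frob_notMem hne ?_, Nat.sub_sub_self hxF⟩
      have h0 := hA 0 hT.1
      have h1 := hxA _ h0
      rwa [add_zero, Nat.add_sub_cancel' hxF] at h1
    · exact Or.inl hxA
  have h1 := Set.ncard_le_ncard hsub (hfin.union (hfin.image _))
  have h2 := Set.ncard_union_le (A T)ᶜ ((fun x => frob T - x) '' (A T)ᶜ)
  have h3 := Set.ncard_image_le (f := fun x => frob T - x) hfin
  rw [← Finset.coe_Iic, Set.ncard_coe_finset, Nat.card_Iic] at h1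
  rw [genus]
  omega

/-- The numerical set with Frobenius number `F` whose nonzero elements below `F` are the
reflections `F - x` of the gaps `x` of `T`. -/
def reflect (F : ℕ) (T : Set ℕ) : Set ℕ := {s | s = 0 ∨ F < s ∨ s ≤ F ∧ F - s ∉ T}

section Reflect

variable {F : ℕ} {T : Set ℕ}

theorem numericalSet_reflect : NumericalSet (reflect F T) := by
  refine ⟨Or.inl rfl, (Set.finite_Iic F).subset fun x hx =>
    Set.mem_Iic.mpr <| not_lt.mp fun hlt => hx ?_⟩
  exact Or.inr (Or.inl hlt)

theorem frob_reflect (hT : NumericalSet T) (hF : 0 < F) : frob (reflect F T) = F := by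
  refine frob_eq_of_isGreatest ⟨?_, fun x hx => not_lt.mp fun hlt => hx (Or.inr (Or.inl hlt))⟩
  rintro (h | h | h)
  · omega
  · omega
  · exact h.2 (by simpa using hT.1)

theorem numericalSemigroup_reflect (hT : NumericalSet T) (hF : 2 * frob T < F) :
    NumericalSemigroup (reflect F T) := by
  have hlarge : ∀ s, s ∈ reflect F T → s = 0 ∨ F < 2 * s := by
    rintro s (hs | hs | ⟨-, hs⟩)
    · exact Or.inl hs
    · exact Or.inr (by omega)
    · have : F - s ≤ frob T := not_lt.mp fun hlt => hs (hT.mem_of_frob_lt hlt)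
      exact Or.inr (by omega)
  refine ⟨numericalSet_reflect, fun a ha b hb => ?_⟩
  rcases hlarge a ha with rfl | ha'
  · rwa [zero_add]
  rcases hlarge b hb with rfl | hb'
  · rwa [add_zero]
  exact Or.inr (Or.inl (by omega))

theorem Tset_reflect (hT : NumericalSet T) (hF : frob T < F) : Tset (reflect F T) = T := by
  ext x
  rw [Tset, Set.mem_ofPred_eq, frob_reflect hT (by omega)]
  rcases le_or_gt F x with hx | hx
  · exact iff_of_true (Or.inr (by omega)) (hT.mem_of_frob_lt (by omega))
  · have h1 : F - x ≠ 0 := by omega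
    have h2 : ¬ F < F - x := by omega
    have h3 : F - x ≤ F := by omega
    simp [reflect, h1, h2, Nat.sub_sub_self hx.le]

end Reflect

theorem stmt_5 (α F : ℕ) (hα : 0 < α) (hF : 0 < F) (h : 4 * (α : ℤ) - 6 < (F : ℤ)) :
    Set.BijOn Tset
      {S : Set ℕ | NumericalSemigroup S ∧ frob S = F ∧ (typ S : ℤ) = (F : ℤ) - (α : ℤ)}
      {T : Set ℕ | NumericalSet T ∧ genus T + genus (A T) = α} := by
  refine ⟨?_, ?_, ?_⟩
  · rintro S ⟨hS, rfl, ht⟩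
    have := hS.genus_Tset_add_genus_A_Tset_add_typ hF
    exact ⟨hS.1.tset hF, by omega⟩
  · rintro S ⟨hS, hSF, -⟩ S' ⟨hS', hSF', -⟩ hST
    exact hS.1.eq_of_Tset_eq hS'.1 (hSF.trans hSF'.symm) hST
  · rintro T ⟨hT, hg⟩
    have hne : Tᶜ.Nonempty := by
      rw [Set.nonempty_compl]
      rintro rfl
      simp [genus, A] at hg
      omega
    have hgpos : 0 < genus T := (Set.ncard_pos hT.2).mpr hne
    have hlt := hT.frob_lt_two_mul_genus_A hne
    have hS := numericalSemigroup_reflect (F := F) hT (by omega)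
    have hSF := frob_reflect hT hF
    have hST : Tset (reflect F T) = T := Tset_reflect hT (by omega)
    have hsum := hS.genus_Tset_add_genus_A_Tset_add_typ (hSF.symm ▸ hF)
    rw [hST, hSF] at hsum
    exact ⟨reflect F T, ⟨hS, hSF, by omega⟩, hST⟩
end

section
/- A numerical semigroup S ≠ ℕ satisfies t(S)·(F(S) + 1 − g(S)) = g(S) if and only if either S is symmetric, or there exist integers m ≥ 2 and n ≥ 1 such that S = {0, m, 2m, …, nm} ∪ {x ∈ ℕ : x ≥ nm}. -/
open scoped Classical

/-- Membership of an integer in a numerical set viewed inside ℤ. -/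
def memZ (S : Set ℕ) (x : ℤ) : Prop := ∃ n ∈ S, (n : ℤ) = x

/-- Symmetric numerical semigroup: for every integer `x`,
`x ∈ S ↔ F(S) - x ∉ S` (inside ℤ). -/
def SymmetricNS (S : Set ℕ) : Prop :=
  ∀ x : ℤ, memZ S x ↔ ¬ memZ S ((frob S : ℤ) - x)

section NumericalSemigroupGaps

variable {S : Set ℕ}

theorem le_frob_of_notMem (hS : NumericalSemigroup S) {x : ℕ} (hx : x ∉ S) : x ≤ frob S :=
  le_csSup hS.1.2.bddAbove hx

theorem mem_of_frob_lt (hS : NumericalSemigroup S) {x : ℕ} (hx : frob S < x) : x ∈ S := by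
  by_contra h
  exact absurd (le_frob_of_notMem hS h) (by omega)

theorem frob_notMem_s17 (hS : NumericalSemigroup S) (hne : S ≠ Set.univ) : frob S ∉ S :=
  Nat.sSup_mem (Set.nonempty_compl.2 hne) hS.1.2.bddAbove

theorem frob_mem_PF_s17 (hS : NumericalSemigroup S) (hne : S ≠ Set.univ) : frob S ∈ PF S :=
  ⟨frob_notMem_s17 hS hne, fun _ _ h0 => mem_of_frob_lt hS (by omega)⟩

theorem PF_finite (hS : NumericalSemigroup S) : (PF S).Finite :=
  hS.1.2.subset fun _ hx => hx.1

/-- The elements of `S` up to the Frobenius number. -/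
noncomputable def leftElements (S : Set ℕ) : Finset ℕ :=
  (Finset.range (frob S + 1)).filter (· ∈ S)

theorem mem_leftElements {x : ℕ} : x ∈ leftElements S ↔ x ≤ frob S ∧ x ∈ S := by
  simp [leftElements]

theorem genus_add_card_leftElements (hS : NumericalSemigroup S) :
    genus S + (leftElements S).card = frob S + 1 := by
  have h : Sᶜ = ((Finset.range (frob S + 1)).filter (· ∉ S) : Finset ℕ) := by
    ext x
    simp only [Set.mem_compl_iff, Finset.coe_filter, Finset.mem_range, Set.mem_ofPred_eq]
    exact ⟨fun hx => ⟨by have := le_frob_of_notMem hS hx; omega, hx⟩, fun hx => hx.2⟩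
  have h2 := Finset.card_filter_add_card_filter_not (s := Finset.range (frob S + 1)) (· ∈ S)
  rw [genus, h, Set.ncard_coe_finset, leftElements]
  rw [Finset.card_range] at h2
  omega

/-- Every gap lies below some pseudo-Frobenius number in the order induced by `S`. -/
theorem exists_PF_eq_add (hS : NumericalSemigroup S) {x : ℕ} (hx : x ∉ S) :
    ∃ f ∈ PF S, ∃ s ∈ S, f = x + s := by
  have hfin : {y | y ∉ S ∧ ∃ s ∈ S, y = x + s}.Finite := hS.1.2.subset fun _ hy => hy.1
  obtain ⟨f, ⟨hf, s, hs, rfl⟩, hmax⟩ :=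
    hfin.exists_maximal ⟨x, hx, 0, hS.1.1, rfl⟩
  refine ⟨x + s, ⟨hf, fun h hh h0 => ?_⟩, s, hs, rfl⟩
  by_contra hc
  have := hmax ⟨hc, s + h, hS.2 s hs h hh, by ring⟩ (by omega)
  omega

/-- If `g = t * n`, then subtracting elements of `S` from pseudo-Frobenius numbers enumerates
the gaps without repetition. -/
theorem PF_sub_bijective_of_genus_eq (hS : NumericalSemigroup S)
    (h : typ S * (leftElements S).card = genus S) :
    (∀ f ∈ PF S, ∀ s ∈ leftElements S, s ≤ f) ∧
      ∀ f ∈ PF S, ∀ f' ∈ PF S, ∀ s ∈ leftElements S, ∀ s' ∈ leftElements S,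
        f + s' = f' + s → f = f' := by
  have hex : ∀ x, ∃ p : ℕ × ℕ, x ∉ S → p.1 ∈ PF S ∧ p.2 ∈ leftElements S ∧ p.1 = x + p.2 := by
    intro x
    by_cases hx : x ∈ S
    · exact ⟨(0, 0), fun h => absurd hx h⟩
    · obtain ⟨f, hf, s, hs, e⟩ := exists_PF_eq_add hS hx
      have := le_frob_of_notMem hS hf.1
      exact ⟨(f, s), fun _ => ⟨hf, mem_leftElements.2 ⟨by omega, hs⟩, e⟩⟩
  choose φ hφ using hex
  have hP := PF_finite hS
  have hG := hS.1.2
  have himg : hG.toFinset.image φ = hP.toFinset ×ˢ leftElements S := by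
    apply Finset.eq_of_subset_of_card_le
    · intro p hp
      obtain ⟨x, hx, rfl⟩ := Finset.mem_image.1 hp
      have := hφ x (by simpa using hx)
      simp [this.1, this.2.1]
    · rw [Finset.card_image_of_injOn, Finset.card_product, ← Set.ncard_eq_toFinset_card _ hP,
        ← Set.ncard_eq_toFinset_card _ hG]
      · exact h.le
      · intro x hx y hy e
        have h1 := (hφ x (by simpa using hx)).2.2
        have h2 := (hφ y (by simpa using hy)).2.2
        rw [e] at h1
        omega
  have key : ∀ f ∈ PF S, ∀ s ∈ leftElements S, ∃ x, φ x = (f, s) ∧ f = x + s := by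
    intro f hf s hs
    have hm : (f, s) ∈ hG.toFinset.image φ := by
      rw [himg]
      simp [hf, hs]
    obtain ⟨x, hx, e⟩ := Finset.mem_image.1 hm
    have := (hφ x (by simpa using hx)).2.2
    rw [e] at this
    exact ⟨x, e, this⟩
  refine ⟨fun f hf s hs => ?_, fun f hf f' hf' s hs s' hs' e => ?_⟩
  · obtain ⟨x, -, hx⟩ := key f hf s hs
    omega
  · obtain ⟨x, hx, e1⟩ := key f hf s hs
    obtain ⟨y, hy, e2⟩ := key f' hf' s' hs'
    obtain rfl : x = y := by omega
    rw [hx] at hy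
    exact (Prod.ext_iff.1 hy).1

theorem symmetricNS_of_PF_eq_singleton (hS : NumericalSemigroup S) (hne : S ≠ Set.univ)
    (h : PF S = {frob S}) : SymmetricNS S := by
  intro x
  constructor
  · rintro ⟨a, ha, rfl⟩ ⟨b, hb, e⟩
    have hab := hS.2 a ha b hb
    rw [show a + b = frob S by omega] at hab
    exact frob_notMem_s17 hS hne hab
  · intro hx
    by_contra hc
    rcases lt_or_ge x 0 with h0 | h0
    · exact hx ⟨(frob S - x).toNat, mem_of_frob_lt hS (by omega), by omega⟩
    · lift x to ℕ using h0
      have hxS : x ∉ S := fun hxS => hc ⟨x, hxS, rfl⟩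
      obtain ⟨f, hf, s, hs, e⟩ := exists_PF_eq_add hS hxS
      rw [h, Set.mem_singleton_iff] at hf
      exact hx ⟨s, hs, by omega⟩

theorem SymmetricNS.mem_iff (h : SymmetricNS S) {x : ℕ} (hx : x ≤ frob S) :
    x ∈ S ↔ frob S - x ∉ S := by
  have hmem : ∀ n : ℕ, memZ S n ↔ n ∈ S := fun n =>
    ⟨fun ⟨a, ha, e⟩ => by rwa [← Int.natCast_inj.1 e], fun hn => ⟨n, hn, rfl⟩⟩
  have := h x
  rwa [← Nat.cast_sub hx, hmem, hmem] at this

theorem SymmetricNS.PF_eq_singleton (h : SymmetricNS S) (hS : NumericalSemigroup S)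
    (hne : S ≠ Set.univ) : PF S = {frob S} := by
  ext f
  rw [Set.mem_singleton_iff]
  refine ⟨fun hf => ?_, fun e => e ▸ frob_mem_PF_s17 hS hne⟩
  by_contra hc
  have hle := le_frob_of_notMem hS hf.1
  have hm : frob S - f ∈ S := by
    by_contra hm
    exact hf.1 ((h.mem_iff hle).2 hm)
  have := hf.2 _ hm (by omega)
  rw [Nat.add_sub_cancel' hle] at this
  exact frob_notMem_s17 hS hne this

theorem SymmetricNS.genus_eq (h : SymmetricNS S) (hS : NumericalSemigroup S) :
    (leftElements S).card = genus S := by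
  rw [genus, Set.ncard_eq_toFinset_card _ hS.1.2]
  refine Finset.card_bij' (fun x _ => frob S - x) (fun x _ => frob S - x) ?_ ?_ ?_ ?_
  · intro x hx
    rw [mem_leftElements] at hx
    simpa using (h.mem_iff hx.1).1 hx.2
  · intro x hx
    have hx : x ∉ S := by simpa using hx
    have hle := le_frob_of_notMem hS hx
    rw [mem_leftElements]
    refine ⟨by omega, ?_⟩
    by_contra hc
    exact hx ((h.mem_iff hle).2 hc)
  · intro x hx
    rw [mem_leftElements] at hx
    omega
  · intro x hx
    have := le_frob_of_notMem hS (show x ∉ S by simpa using hx)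
    omega

theorem mul_mem_of_mem (hS : NumericalSemigroup S) {m : ℕ} (hm : m ∈ S) (k : ℕ) : k * m ∈ S := by
  induction k with
  | zero => simpa using hS.1.1
  | succ k ih => simpa [add_mul] using hS.2 _ ih _ hm

/-- A semigroup with `g = t * n` and at least two pseudo-Frobenius numbers consists of the
multiples of some `m` up to its conductor. -/
theorem exists_eq_multiples_of_genus_eq (hS : NumericalSemigroup S) (hne : S ≠ Set.univ)
    (h : typ S * (leftElements S).card = genus S) (hPF : PF S ≠ {frob S}) :
    ∃ m n : ℕ, 2 ≤ m ∧ 1 ≤ n ∧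
      S = {x : ℕ | ∃ k ≤ n, x = k * m} ∪ {x : ℕ | n * m ≤ x} := by
  obtain ⟨hle, huniq⟩ := PF_sub_bijective_of_genus_eq hS h
  have hF := frob_notMem_s17 hS hne
  have hFP := frob_mem_PF_s17 hS hne
  have h0 : 0 ∈ leftElements S := mem_leftElements.2 ⟨by omega, hS.1.1⟩
  obtain ⟨L, hL, hLmax⟩ := (leftElements S).exists_max_image id ⟨0, h0⟩
  simp only [id] at hLmax
  have hLS := (mem_leftElements.1 hL).2
  have hLF : L < frob S := lt_of_le_of_ne (mem_leftElements.1 hL).1 fun e => hF (e ▸ hLS)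
  have hgap : ∀ x, L < x → x ≤ frob S → x ∉ S := fun x h1 h2 hx =>
    absurd (hLmax x (mem_leftElements.2 ⟨h2, hx⟩)) (by omega)
  have hmin : ∀ s ∈ S, s ≠ 0 → frob S < L + s := fun s hs hs0 => by
    by_contra hc
    exact hgap (L + s) (by omega) (by omega) (hS.2 L hLS s hs)
  have hPFiff : ∀ f, f ∈ PF S ↔ L < f ∧ f ≤ frob S := fun f => by
    constructor
    · intro hf
      refine ⟨lt_of_le_of_ne (hle f hf L hL) fun e => hf.1 (e ▸ hLS), le_frob_of_notMem hS hf.1⟩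
    · rintro ⟨h1, h2⟩
      exact ⟨hgap f h1 h2, fun s hs hs0 => mem_of_frob_lt hS (by have := hmin s hs hs0; omega)⟩
  obtain ⟨t, ht⟩ : ∃ t, frob S = L + t := ⟨frob S - L, by omega⟩
  have ht2 : 2 ≤ t := by
    by_contra hc
    apply hPF
    ext f
    rw [hPFiff, Set.mem_singleton_iff]
    omega
  have hdiff : ∀ a ∈ leftElements S, ∀ b ∈ leftElements S, a < b → a + t ≤ b := by
    intro a ha b hb hab
    by_contra hc
    have := huniq (frob S) hFP (frob S - (b - a)) ((hPFiff _).2 (by omega)) b hb a ha (by omega)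
    omega
  have hrep : ∀ x, x ∉ S → ∃ s ∈ leftElements S, L < x + s ∧ x + s ≤ frob S := by
    intro x hx
    obtain ⟨f, hf, s, hs, rfl⟩ := exists_PF_eq_add hS hx
    have := (hPFiff _).1 hf
    exact ⟨s, mem_leftElements.2 ⟨by omega, hs⟩, this⟩
  have htile : ∀ s ∈ leftElements S, ∀ x, L < x + s → x + s ≤ frob S → x ∉ S := by
    intro s hs x h1 h2 hx
    exact hgap _ h1 h2 (hS.2 x hx s (mem_leftElements.1 hs).2)
  have hm : t + 1 ∈ S := by
    by_contra hc
    obtain ⟨s, hs, h1, h2⟩ := hrep _ hc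
    have hs2 : L = s + t := by
      by_contra hne'
      have := huniq (frob S) hFP (t + s) ((hPFiff _).2 (by omega)) L hL s hs (by omega)
      omega
    have hg : s + 1 ∉ S := fun hh => by
      have := hdiff s hs (s + 1) (mem_leftElements.2 ⟨by omega, hh⟩) (by omega)
      omega
    obtain ⟨u, hu, h3, h4⟩ := hrep _ hg
    rcases Nat.lt_or_ge t u with h5 | h5
    · exact htile u hu s (by omega) (by omega) (mem_leftElements.1 hs).2
    · exact htile u hu L (by
        rcases Nat.eq_zero_or_pos u with rfl | h6 <;> omega) (by omega) hLS
  have hmul : ∀ s ∈ leftElements S, s % (t + 1) = 0 := by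
    intro s hs
    by_contra hc
    have hlt := Nat.mod_lt s (show t + 1 > 0 by omega)
    have hdm := Nat.div_add_mod' s (t + 1)
    have hq := mul_mem_of_mem hS hm (s / (t + 1))
    have hsL := hLmax s hs
    have h1 := hdiff _ (mem_leftElements.2 ⟨by omega, hq⟩) s hs (by omega)
    have h2 := hS.2 _ hq _ hm
    rw [show s / (t + 1) * (t + 1) + (t + 1) = s + 1 by omega] at h2
    have := hdiff s hs (s + 1) (mem_leftElements.2 ⟨by omega, h2⟩) (by omega)
    omega
  have hLq := Nat.div_add_mod' L (t + 1)
  rw [hmul L hL] at hLq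
  have hcond : (L / (t + 1) + 1) * (t + 1) = frob S + 1 := by
    rw [add_mul]
    omega
  refine ⟨t + 1, L / (t + 1) + 1, by omega, Nat.le_add_left _ _, ?_⟩
  ext x
  simp only [Set.mem_union, Set.mem_ofPred_eq, hcond]
  constructor
  · intro hx
    rcases Nat.lt_or_ge (frob S) x with h1 | h1
    · exact Or.inr h1
    · have hxl := mem_leftElements.2 ⟨h1, hx⟩
      have hxm := Nat.div_add_mod' x (t + 1)
      rw [hmul x hxl] at hxm
      exact Or.inl ⟨x / (t + 1), (Nat.div_le_div_right (hLmax x hxl)).trans (by omega), by omega⟩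
  · rintro (⟨k, -, rfl⟩ | h1)
    · exact mul_mem_of_mem hS hm k
    · exact mem_of_frob_lt hS h1

theorem genus_eq_of_eq_multiples (hS : NumericalSemigroup S) {m n : ℕ} (hm : 2 ≤ m)
    (h : S = {x : ℕ | ∃ k ≤ n + 1, x = k * m} ∪ {x : ℕ | (n + 1) * m ≤ x}) :
    typ S * (leftElements S).card = genus S := by
  have hmem : ∀ x, x ∈ S ↔ (∃ k ≤ n + 1, x = k * m) ∨ n * m + m ≤ x := fun x => by
    conv_lhs => rw [h]
    simp [add_mul]
  have hgap : ∀ x, n * m < x → x < n * m + m → x ∉ S := by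
    intro x h1 h2 hx
    rcases (hmem x).1 hx with ⟨k, -, rfl⟩ | h3
    · have h4 := Nat.lt_of_mul_lt_mul_right h1
      have h5 : k < n + 1 := Nat.lt_of_mul_lt_mul_right (a := m) (by rwa [add_mul, one_mul])
      omega
    · omega
  have hF : frob S + 1 = n * m + m := by
    have h1 := le_frob_of_notMem hS (hgap (n * m + m - 1) (by omega) (by omega))
    by_contra hc
    have h2 : S ≠ Set.univ := fun e => hgap (n * m + m - 1) (by omega) (by omega) (e ▸ trivial)
    exact frob_notMem_s17 hS h2 ((hmem _).2 (Or.inr (by omega)))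
  have hleft : leftElements S = (Finset.range (n + 1)).image (· * m) := by
    ext x
    rw [mem_leftElements, hmem]
    simp only [Finset.mem_image, Finset.mem_range]
    constructor
    · rintro ⟨h1, ⟨k, hk, rfl⟩ | h2⟩
      · exact ⟨k, Nat.lt_of_mul_lt_mul_right (a := m) (by rw [add_mul]; omega), rfl⟩
      · omega
    · rintro ⟨k, hk, rfl⟩
      have := Nat.mul_le_mul_right m (show k ≤ n by omega)
      exact ⟨by omega, Or.inl ⟨k, by omega, rfl⟩⟩
  have hcard : (leftElements S).card = n + 1 := by
    rw [hleft, Finset.card_image_of_injective _ fun a b e =>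
      Nat.eq_of_mul_eq_mul_right (show 0 < m by omega) e, Finset.card_range]
  have hPF : PF S = (Finset.Ioo (n * m) (n * m + m) : Finset ℕ) := by
    ext f
    simp only [Finset.coe_Ioo, Set.mem_Ioo]
    constructor
    · intro hf
      have h1 := le_frob_of_notMem hS hf.1
      refine ⟨?_, by omega⟩
      by_contra hc
      rcases Nat.eq_zero_or_pos n with rfl | hn
      · exact hf.1 ((by omega : f = 0) ▸ hS.1.1)
      have hnm : n * m ∈ S := (hmem _).2 (Or.inl ⟨n, by omega, rfl⟩)
      have h2 : f ≠ n * m := fun e => hf.1 (e ▸ hnm)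
      have h3 := hf.2 m ((hmem _).2 (Or.inl ⟨1, by omega, by simp⟩)) (by omega)
      rcases (hmem _).1 h3 with ⟨k, hk, e⟩ | h4
      · rcases k with _ | k
        · omega
        · rw [add_mul] at e
          exact hf.1 ((hmem _).2 (Or.inl ⟨k, by omega, by omega⟩))
      · omega
    · rintro ⟨h1, h2⟩
      refine ⟨hgap f h1 h2, fun s hs hs0 => (hmem _).2 (Or.inr ?_)⟩
      rcases (hmem s).1 hs with ⟨k, hk, rfl⟩ | h3
      · have : 1 ≤ k := Nat.pos_of_ne_zero (left_ne_zero_of_mul hs0)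
        have := Nat.mul_le_mul_right m this
        omega
      · omega
  have hg := genus_add_card_leftElements hS
  rw [hcard, hF] at hg
  rw [typ, hPF, Set.ncard_coe_finset, Nat.card_Ioo, hcard]
  obtain ⟨c, rfl⟩ : ∃ c, m = c + 1 := ⟨m - 1, by omega⟩
  rw [show n * (c + 1) + (c + 1) - n * (c + 1) - 1 = c by omega]
  linarith

end NumericalSemigroupGaps

theorem stmt_17 (S : Set ℕ) (hS : NumericalSemigroup S) (hne : S ≠ Set.univ) :
    typ S * (frob S + 1 - genus S) = genus S ↔
      SymmetricNS S ∨
        ∃ m n : ℕ, 2 ≤ m ∧ 1 ≤ n ∧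
          S = {x : ℕ | ∃ k ≤ n, x = k * m} ∪ {x : ℕ | n * m ≤ x} := by
  have hg := genus_add_card_leftElements hS
  rw [show frob S + 1 - genus S = (leftElements S).card by omega]
  constructor
  · intro h
    by_cases hPF : PF S = {frob S}
    · exact Or.inl (symmetricNS_of_PF_eq_singleton hS hne hPF)
    · exact Or.inr (exists_eq_multiples_of_genus_eq hS hne h hPF)
  · rintro (h | ⟨m, n, hm, hn, h⟩)
    · rw [typ, h.PF_eq_singleton hS hne, Set.ncard_singleton, one_mul, h.genus_eq hS]
    · obtain ⟨n, rfl⟩ : ∃ k, n = k + 1 := ⟨n - 1, by omega⟩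
      exact genus_eq_of_eq_multiples hS hm h
end
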